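/- arXiv:2009.00241 — 5 statements merged into one kernel-verified Lean document; each statement's English description precedes it below -/
import Mathlib

section
/- Let f : (0,∞) → ℝ admit the representation f(t) = a + b·t + ∫₀^∞ (tλ)/(t+λ) dw(λ) for all t > 0, where a ∈ ℝ, b ≥ 0 and w is a positive measure on (0,∞) with ∫₀^∞ λ/(1+λ) dw(λ) < ∞. Then for all strictly positive operators U, V on a complex Hilbert space H, f(V) − f(U) = b(V − U) + ∫₀^∞ λ² [ ∫₀¹ ((1−t)U + tV + λ)⁻¹ (V − U) ((1−t)U + tV + λ)⁻¹ dt ] dw(λ), where f(U), f(V) are defined by the continuous functional calculus and the integrals are Bochner integrals of operator-valued functions. -/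
open MeasureTheory

variable {H : Type*} [NormedAddCommGroup H] [InnerProductSpace ℂ H] [CompleteSpace H]

/-- An operator `T` on a complex Hilbert space is *strictly positive* if
`⟪T x, x⟫ ≥ 0` for all `x` and `T` is invertible. -/
def StrictlyPos (T : H →L[ℂ] H) : Prop := T.IsPositive ∧ IsUnit T

/-- `A^{1/2}` via the continuous functional calculus. -/
noncomputable def opSqrt (A : H →L[ℂ] H) : H →L[ℂ] H := cfc Real.sqrt A

/-- `A^{-1/2}` via the continuous functional calculus. -/
noncomputable def opInvSqrt (A : H →L[ℂ] H) : H →L[ℂ] H :=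
  cfc (fun x : ℝ => (Real.sqrt x)⁻¹) A

/-- The noncommutative perspective `𝒫_f(B, A) := A^{1/2} f(A^{-1/2} B A^{-1/2}) A^{1/2}`. -/
noncomputable def persp (f : ℝ → ℝ) (B A : H →L[ℂ] H) : H →L[ℂ] H :=
  opSqrt A * cfc f (opInvSqrt A * B * opInvSqrt A) * opSqrt A

/-- The weighted operator geometric mean `A ♯_ν B := A^{1/2} (A^{-1/2} B A^{-1/2})^ν A^{1/2}`. -/
noncomputable def gmean (ν : ℝ) (A B : H →L[ℂ] H) : H →L[ℂ] H :=
  opSqrt A * cfc (fun x : ℝ => x ^ ν) (opInvSqrt A * B * opInvSqrt A) * opSqrt A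

/-- The relative operator entropy `S(A|B) := A^{1/2} ln(A^{-1/2} B A^{-1/2}) A^{1/2}`. -/
noncomputable def relEntropy (A B : H →L[ℂ] H) : H →L[ℂ] H :=
  opSqrt A * cfc Real.log (opInvSqrt A * B * opInvSqrt A) * opSqrt A

open Set in
/-- If every point `(1 - t) • X + t • Y` of the segment is a unit, then
`∫₀¹ ((1-t)X + tY)⁻¹ (Y - X) ((1-t)X + tY)⁻¹ dt = X⁻¹ - Y⁻¹`. -/
lemma intervalIntegral_ringInverse_mul_sub_mul_ringInverse {A : Type*} [NormedRing A]
    [NormedAlgebra ℝ A] [CompleteSpace A] {X Y : A}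
    (h : ∀ t ∈ Icc (0 : ℝ) 1, IsUnit ((1 - t) • X + t • Y)) :
    ∫ t in (0 : ℝ)..1, Ring.inverse ((1 - t) • X + t • Y) * (Y - X) *
      Ring.inverse ((1 - t) • X + t • Y) = Ring.inverse X - Ring.inverse Y := by
  have hderiv : ∀ t ∈ uIcc (0 : ℝ) 1,
      HasDerivAt (fun s : ℝ => -Ring.inverse ((1 - s) • X + s • Y))
        (Ring.inverse ((1 - t) • X + t • Y) * (Y - X) * Ring.inverse ((1 - t) • X + t • Y)) t := by
    intro t ht
    rw [uIcc_of_le zero_le_one] at ht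
    have h₁ : HasDerivAt (fun s : ℝ => (1 - s) • X + s • Y) (Y - X) t := by
      convert! (((hasDerivAt_id t).const_sub 1).smul_const X).add
        ((hasDerivAt_id t).smul_const Y) using 1
      simp [sub_eq_add_neg, add_comm]
    obtain ⟨u, hu⟩ := h t ht
    have h₂ : HasFDerivAt Ring.inverse _ ((1 - t) • X + t • Y) :=
      hu ▸ hasFDerivAt_ringInverse (𝕜 := ℝ) u
    convert! (h₂.comp_hasDerivAt t h₁).neg using 1
    simp [← hu]
  have hcont : ContinuousOn (fun t : ℝ => Ring.inverse ((1 - t) • X + t • Y))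
      (uIcc (0 : ℝ) 1) := by
    simpa only [neg_neg] using (HasDerivAt.continuousOn hderiv).fun_neg
  rw [intervalIntegral.integral_eq_sub_of_hasDerivAt hderiv
    ((hcont.mul continuousOn_const).mul hcont).intervalIntegrable]
  simp [sub_eq_add_neg, add_comm]

/-- The resolvent form of `T l (T + l)⁻¹`: it equals `l - l² (T + l)⁻¹`. -/
lemma cfc_mul_div_add_eq {T : H →L[ℂ] H} (hT : 0 ≤ T) {l : ℝ} (hl : 0 < l) :
    cfc (fun z : ℝ => z * l / (z + l)) T = l • 1 - l ^ 2 • Ring.inverse (T + l • 1) := by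
  have hsa : IsSelfAdjoint T := .of_nonneg hT
  have hne : ∀ z ∈ spectrum ℝ T, z + l ≠ 0 := fun z hz =>
    (add_pos_of_nonneg_of_pos (spectrum_nonneg_of_nonneg hT hz) hl).ne'
  have hinv : ContinuousOn (fun z : ℝ => (z + l)⁻¹) (spectrum ℝ T) :=
    (by fun_prop : ContinuousOn (fun z : ℝ => z + l) _).inv₀ hne
  have hres : cfc (fun z : ℝ => (z + l)⁻¹) T = Ring.inverse (T + l • 1) := by
    rw [cfc_inv (fun z : ℝ => z + l) T hne, cfc_add_const l (fun z : ℝ => z) T, cfc_id' ℝ T,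
      Algebra.algebraMap_eq_smul_one]
  calc cfc (fun z : ℝ => z * l / (z + l)) T
      = cfc (fun z : ℝ => l - l ^ 2 * (z + l)⁻¹) T := by
        refine cfc_congr fun z hz => ?_
        have := hne z hz
        field_simp
        ring
    _ = l • 1 - l ^ 2 • Ring.inverse (T + l • 1) := by
        rw [cfc_sub (fun _ : ℝ => l) (fun z : ℝ => l ^ 2 * (z + l)⁻¹) T continuousOn_const
          (hinv.const_mul _), cfc_const l T, cfc_const_mul _ _ T hinv, hres,
          Algebra.algebraMap_eq_smul_one]

open Set in
/-- If `f(t) = a + b t + ∫₀^∞ t l / (t + l) dw(l)` on `(0, ∞)`, then the same representation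
holds for `f(T)`, with `T` strictly positive, as a Bochner integral. -/
lemma cfc_eq_add_integral_of_integral_repr {f : ℝ → ℝ} {a b : ℝ} {w : Measure ℝ}
    (hf : ContinuousOn f (Ioi 0))
    (hw : IntegrableOn (fun l => l / (1 + l)) (Ioi 0) w)
    (hrep : ∀ t > (0 : ℝ), f t = a + b * t + ∫ l in Ioi 0, t * l / (t + l) ∂w)
    {T : H →L[ℂ] H} (hT : IsStrictlyPositive T) :
    IntegrableOn (fun l => cfc (fun z : ℝ => z * l / (z + l)) T) (Ioi 0) w ∧
      cfc f T = a • 1 + b • T + ∫ l in Ioi 0, cfc (fun z : ℝ => z * l / (z + l)) T ∂w := by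
  have hsa : IsSelfAdjoint T := hT.isSelfAdjoint
  have hpos : ∀ z ∈ spectrum ℝ T, 0 < z := fun z hz => hT.spectrum_pos hz
  have hfT : ContinuousOn f (spectrum ℝ T) := hf.mono hpos
  set C : ℝ := 1 + ‖T‖ * ‖(1 : H →L[ℂ] H)‖
  have hcont : ContinuousOn (Function.uncurry fun l z : ℝ => z * l / (z + l))
      (Ioi 0 ×ˢ spectrum ℝ T) := by
    refine ContinuousOn.div (by fun_prop) (by fun_prop) fun p hp => ?_
    exact (add_pos (hpos _ hp.2) hp.1).ne'
  have hbound : ∀ᵐ l ∂w.restrict (Ioi 0), ∀ z ∈ spectrum ℝ T,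
      ‖z * l / (z + l)‖ ≤ C * (l / (1 + l)) := by
    refine (ae_restrict_iff' measurableSet_Ioi).2 (.of_forall fun l (hl : 0 < l) z hz => ?_)
    have hz₀ := hpos z hz
    have hzC : 1 + z ≤ C := by
      have := (le_abs_self z).trans (spectrum.norm_le_norm_mul_of_mem hz)
      simpa [C] using this
    rw [Real.norm_of_nonneg (by positivity), ← mul_div_assoc,
      div_le_div_iff₀ (by positivity) (by positivity)]
    calc z * l * (1 + l) ≤ (1 + z) * l * (z + l) := by nlinarith [mul_pos hz₀ hl]
      _ ≤ C * l * (z + l) := by gcongr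
  have hfin : HasFiniteIntegral (fun l => C * (l / (1 + l))) (w.restrict (Ioi 0)) :=
    (hw.const_mul C).2
  refine ⟨integrableOn_cfc measurableSet_Ioi _ _ T hcont hbound hfin, ?_⟩
  rw [← cfc_setIntegral measurableSet_Ioi _ _ T hcont hbound hfin]
  have hint : ContinuousOn (fun z : ℝ => ∫ l in Ioi 0, z * l / (z + l) ∂w) (spectrum ℝ T) := by
    refine ContinuousOn.congr (f := fun z => f z - (a + b * z)) (by fun_prop) fun z hz => ?_
    simp [hrep z (hpos z hz)]
  have haff : cfc (fun z : ℝ => a + b * z) T = a • 1 + b • T := by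
    rw [cfc_const_add a (fun z : ℝ => b * z) T, cfc_const_mul_id b T,
      Algebra.algebraMap_eq_smul_one]
  rw [← haff, ← cfc_add T (fun z : ℝ => a + b * z) _ (by fun_prop) hint]
  exact cfc_congr fun z hz => hrep z (hpos z hz)

/-- **Lemma 2.1.** If `f(t) = a + b t + ∫₀^∞ tλ/(t+λ) dw(λ)` on `(0,∞)`, then for all
strictly positive operators `U, V`,
`f(V) - f(U) = b(V - U) + ∫₀^∞ λ² [∫₀¹ ((1-t)U + tV + λ)⁻¹ (V - U) ((1-t)U + tV + λ)⁻¹ dt] dw(λ)`. -/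
theorem stmt_0 (f : ℝ → ℝ) (a b : ℝ) (hb : 0 ≤ b) (w : Measure ℝ)
    (hf : ContinuousOn f (Set.Ioi 0))
    (hw : IntegrableOn (fun l => l / (1 + l)) (Set.Ioi 0) w)
    (hrep : ∀ t > (0:ℝ), f t = a + b * t + ∫ l in Set.Ioi 0, t * l / (t + l) ∂w)
    (U V : H →L[ℂ] H) (hU : StrictlyPos U) (hV : StrictlyPos V) :
    cfc f V - cfc f U = b • (V - U) +
      ∫ l in Set.Ioi (0:ℝ), l ^ 2 •
        (∫ t in (0:ℝ)..1, Ring.inverse ((1 - t) • U + t • V + l • 1) * (V - U) *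
          Ring.inverse ((1 - t) • U + t • V + l • 1)) ∂w := by
  have hU' : IsStrictlyPositive U :=
    hU.2.isStrictlyPositive ((ContinuousLinearMap.nonneg_iff_isPositive U).2 hU.1)
  have hV' : IsStrictlyPositive V :=
    hV.2.isStrictlyPositive ((ContinuousLinearMap.nonneg_iff_isPositive V).2 hV.1)
  obtain ⟨hUi, hUe⟩ := cfc_eq_add_integral_of_integral_repr hf hw hrep hU'
  obtain ⟨hVi, hVe⟩ := cfc_eq_add_integral_of_integral_repr hf hw hrep hV'
  have hkey : ∀ l ∈ Set.Ioi (0 : ℝ),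
      l ^ 2 • (∫ t in (0:ℝ)..1, Ring.inverse ((1 - t) • U + t • V + l • 1) * (V - U) *
          Ring.inverse ((1 - t) • U + t • V + l • 1)) =
        cfc (fun z : ℝ => z * l / (z + l)) V - cfc (fun z : ℝ => z * l / (z + l)) U := by
    intro l hl
    have hseg : ∀ t : ℝ, (1 - t) • U + t • V + l • 1 =
        (1 - t) • (U + l • 1) + t • (V + l • (1 : H →L[ℂ] H)) := fun t => by module
    have hunit : ∀ t ∈ Set.Icc (0 : ℝ) 1,
        IsUnit ((1 - t) • (U + l • 1) + t • (V + l • (1 : H →L[ℂ] H))) := fun t ht => by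
      rw [← hseg]
      exact ((isStrictlyPositive_one.smul hl).nonneg_add
        (add_nonneg (smul_nonneg (sub_nonneg.2 ht.2) hU'.nonneg)
          (smul_nonneg ht.1 hV'.nonneg))).isUnit
    have hint := intervalIntegral_ringInverse_mul_sub_mul_ringInverse hunit
    simp only [add_sub_add_right_eq_sub] at hint
    simp only [hseg, hint]
    rw [cfc_mul_div_add_eq hU'.nonneg hl, cfc_mul_div_add_eq hV'.nonneg hl]
    module
  rw [setIntegral_congr_fun measurableSet_Ioi hkey, integral_sub hVi hUi, hUe, hVe]
  module
end

section
/- Let f : (0,∞) → ℝ admit the representation f(t) = a + b·t + ∫₀^∞ (tλ)/(t+λ) dw(λ) for all t > 0, where a ∈ ℝ, b ≥ 0 and w is a positive measure on (0,∞) with ∫₀^∞ λ/(1+λ) dw(λ) < ∞. Then for all strictly positive operators A, B, P on a complex Hilbert space H, 𝒫_f(B,P) − 𝒫_f(A,P) = b(B − A) + ∫₀^∞ λ² [ ∫₀¹ P((1−t)A + tB + λP)⁻¹ (B − A) ((1−t)A + tB + λP)⁻¹ P dt ] dw(λ). -/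
open MeasureTheory

variable {H : Type*} [NormedAddCommGroup H] [InnerProductSpace ℂ H] [CompleteSpace H]

theorem strictlyPos_iff_isStrictlyPositive {T : H →L[ℂ] H} :
    StrictlyPos T ↔ IsStrictlyPositive T := by
  rw [StrictlyPos, ← ContinuousLinearMap.nonneg_iff_isPositive]
  exact ⟨fun h => h.2.isStrictlyPositive h.1, fun h => ⟨h.nonneg, h.isUnit⟩⟩

theorem opSqrt_mul_self {P : H →L[ℂ] H} (hP : IsStrictlyPositive P) :
    opSqrt P * opSqrt P = P := by
  rw [opSqrt, ← cfc_mul Real.sqrt Real.sqrt P]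
  conv_rhs => rw [← cfc_id ℝ P]
  refine cfc_congr fun x hx => ?_
  exact Real.mul_self_sqrt (hP.spectrum_pos hx).le

theorem continuousOn_inv_sqrt_spectrum {P : H →L[ℂ] H} (hP : IsStrictlyPositive P) :
    ContinuousOn (fun x : ℝ => (Real.sqrt x)⁻¹) (spectrum ℝ P) :=
  Real.continuous_sqrt.continuousOn.inv₀ fun _ hx =>
    (Real.sqrt_pos.2 (hP.spectrum_pos hx)).ne'

theorem opSqrt_mul_opInvSqrt {P : H →L[ℂ] H} (hP : IsStrictlyPositive P) :
    opSqrt P * opInvSqrt P = 1 := by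
  have hc := continuousOn_inv_sqrt_spectrum hP
  rw [opSqrt, opInvSqrt, ← cfc_mul Real.sqrt (fun x : ℝ => (Real.sqrt x)⁻¹) P, ← cfc_one ℝ P]
  refine cfc_congr fun x hx => ?_
  exact mul_inv_cancel₀ (Real.sqrt_pos.2 (hP.spectrum_pos hx)).ne'

theorem opInvSqrt_mul_opSqrt {P : H →L[ℂ] H} (hP : IsStrictlyPositive P) :
    opInvSqrt P * opSqrt P = 1 := by
  rw [← opSqrt_mul_opInvSqrt hP]
  exact cfc_commute_cfc _ _ P

theorem isStrictlyPositive_opInvSqrt_conj {P B : H →L[ℂ] H} (hP : IsStrictlyPositive P)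
    (hB : IsStrictlyPositive B) :
    IsStrictlyPositive (opInvSqrt P * B * opInvSqrt P) := by
  have hsa : IsSelfAdjoint (opInvSqrt P) := cfc_predicate _ P
  have hu : IsUnit (opInvSqrt P) :=
    ⟨⟨_, _, opInvSqrt_mul_opSqrt hP, opSqrt_mul_opInvSqrt hP⟩, rfl⟩
  exact ((hu.mul hB.isUnit).mul hu).isStrictlyPositive (hsa.conjugate_nonneg hB.nonneg)

theorem isStrictlyPositive_add_smul {A P : H →L[ℂ] H} (hA : IsStrictlyPositive A)
    (hP : IsStrictlyPositive P) {l : ℝ} (hl : 0 < l) : IsStrictlyPositive (A + l • P) :=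
  hA.add_nonneg (smul_nonneg hl.le hP.nonneg)

theorem cfc_mul_div_add {X : H →L[ℂ] H} (hX : IsStrictlyPositive X) {l : ℝ} (hl : 0 < l) :
    cfc (fun t : ℝ => t * l / (t + l)) X =
      l • (1 : H →L[ℂ] H) - l ^ 2 • Ring.inverse (X + l • (1 : H →L[ℂ] H)) := by
  have hne : ∀ x ∈ spectrum ℝ X, x + l ≠ 0 := fun x hx =>
    (add_pos (hX.spectrum_pos hx) hl).ne'
  have hsa : IsSelfAdjoint X := hX.isSelfAdjoint
  have hc : ContinuousOn (fun t : ℝ => (t + l)⁻¹) (spectrum ℝ X) :=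
    ContinuousOn.inv₀ (by fun_prop) hne
  have hadd : cfc (fun t : ℝ => t + l) X = X + l • (1 : H →L[ℂ] H) := by
    rw [cfc_add_const l (fun t : ℝ => t) X, cfc_id' ℝ X, Algebra.algebraMap_eq_smul_one]
  have hinv : Ring.inverse (X + l • (1 : H →L[ℂ] H)) = cfc (fun t : ℝ => (t + l)⁻¹) X := by
    rw [← hadd]
    exact (cfc_inv (fun t : ℝ => t + l) X hne).symm
  rw [hinv, ← cfc_const_mul (l ^ 2) (fun t : ℝ => (t + l)⁻¹) X hc,
    ← Algebra.algebraMap_eq_smul_one, ← cfc_const l X,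
    ← cfc_sub (fun _ : ℝ => l) (fun t : ℝ => l ^ 2 * (t + l)⁻¹) X (by fun_prop)
      (hc.const_mul (l ^ 2))]
  refine cfc_congr fun x hx => ?_
  have := hne x hx
  field_simp
  ring

theorem opSqrt_conj_ringInverse {P B : H →L[ℂ] H} (hP : IsStrictlyPositive P)
    (hB : IsStrictlyPositive B) {l : ℝ} (hl : 0 < l) :
    opSqrt P * Ring.inverse (opInvSqrt P * B * opInvSqrt P + l • (1 : H →L[ℂ] H)) * opSqrt P =
      P * Ring.inverse (B + l • P) * P := by
  have hSS := opSqrt_mul_self hP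
  have hSR := opSqrt_mul_opInvSqrt hP
  have hRS := opInvSqrt_mul_opSqrt hP
  have hQ : IsUnit (B + l • P) := (isStrictlyPositive_add_smul hB hP hl).isUnit
  set S := opSqrt P
  set R := opInvSqrt P
  set Q := B + l • P with hQdef
  have hX : R * B * R + l • (1 : H →L[ℂ] H) = R * Q * R := by
    have : R * P * R = 1 := by
      rw [← hSS, ← mul_assoc, hRS, one_mul, hSR]
    rw [hQdef, mul_add, add_mul, mul_smul_comm, smul_mul_assoc, this]
  have h1 : R * Q * R * (S * Ring.inverse Q * S) = 1 := by
    calc R * Q * R * (S * Ring.inverse Q * S) = R * Q * (R * S) * Ring.inverse Q * S := by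
          noncomm_ring
      _ = 1 := by rw [hRS, mul_one, mul_assoc R, Ring.mul_inverse_cancel _ hQ, mul_one, hRS]
  have h2 : S * Ring.inverse Q * S * (R * Q * R) = 1 := by
    calc S * Ring.inverse Q * S * (R * Q * R) = S * Ring.inverse Q * (S * R) * Q * R := by
          noncomm_ring
      _ = 1 := by rw [hSR, mul_one, mul_assoc S, Ring.inverse_mul_cancel _ hQ, mul_one, hSR]
  have hinv : Ring.inverse (R * Q * R) = S * Ring.inverse Q * S :=
    Ring.inverse_unit (⟨_, _, h1, h2⟩ : (H →L[ℂ] H)ˣ)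
  rw [hX, hinv]
  conv_rhs => rw [← hSS]
  noncomm_ring

theorem abs_mul_div_add_le {t l M : ℝ} (ht : 0 < t) (hl : 0 < l) (hM : t ≤ M) :
    ‖t * l / (t + l)‖ ≤ (1 + M) * (l / (1 + l)) := by
  rw [Real.norm_of_nonneg (by positivity)]
  calc t * l / (t + l) ≤ (1 + t) * (l / (1 + l)) := by
        rw [← mul_div_assoc, div_le_div_iff₀ (by positivity) (by positivity)]
        nlinarith [mul_pos hl hl, mul_pos hl ht, mul_pos (mul_pos ht ht) hl]
    _ ≤ _ := by gcongr

theorem integrableOn_and_cfc_integral_mul_div_add {w : Measure ℝ}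
    (hw : IntegrableOn (fun l => l / (1 + l)) (Set.Ioi 0) w) {X : H →L[ℂ] H}
    (hX : IsStrictlyPositive X) :
    IntegrableOn (fun l : ℝ => cfc (fun t : ℝ => t * l / (t + l)) X) (Set.Ioi 0) w ∧
      cfc (fun t : ℝ => ∫ l in Set.Ioi (0 : ℝ), t * l / (t + l) ∂w) X =
        ∫ l in Set.Ioi (0 : ℝ), cfc (fun t : ℝ => t * l / (t + l)) X ∂w := by
  have hsa : IsSelfAdjoint X := hX.isSelfAdjoint
  have hcont : ContinuousOn (Function.uncurry fun l t : ℝ => t * l / (t + l))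
      (Set.Ioi 0 ×ˢ spectrum ℝ X) := by
    refine ContinuousOn.div (by fun_prop) (by fun_prop) ?_
    rintro ⟨l, t⟩ ⟨hl, ht⟩
    exact (add_pos (hX.spectrum_pos ht) hl).ne'
  have hbound : ∀ᵐ l ∂(w.restrict (Set.Ioi 0)), ∀ t ∈ spectrum ℝ X,
      ‖t * l / (t + l)‖ ≤ (1 + ‖X‖ * ‖(1 : H →L[ℂ] H)‖) * (l / (1 + l)) :=
    ae_restrict_of_forall_mem measurableSet_Ioi fun l hl t ht =>
      abs_mul_div_add_le (hX.spectrum_pos ht) hl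
        ((le_abs_self t).trans (spectrum.norm_le_norm_mul_of_mem ht))
  have hfin := (hw.const_mul (1 + ‖X‖ * ‖(1 : H →L[ℂ] H)‖)).hasFiniteIntegral
  exact ⟨integrableOn_cfc measurableSet_Ioi _ _ X hcont hbound hfin,
    cfc_setIntegral measurableSet_Ioi _ _ X hcont hbound hfin⟩

theorem integrableOn_and_persp_eq {f : ℝ → ℝ} {a b : ℝ} {w : Measure ℝ}
    (hf : ContinuousOn f (Set.Ioi 0))
    (hw : IntegrableOn (fun l => l / (1 + l)) (Set.Ioi 0) w)
    (hrep : ∀ t > (0 : ℝ), f t = a + b * t + ∫ l in Set.Ioi 0, t * l / (t + l) ∂w)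
    {B P : H →L[ℂ] H} (hB : IsStrictlyPositive B) (hP : IsStrictlyPositive P) :
    IntegrableOn (fun l : ℝ => l • P - l ^ 2 • (P * Ring.inverse (B + l • P) * P))
        (Set.Ioi 0) w ∧
      persp f B P = a • P + b • B + ∫ l in Set.Ioi (0 : ℝ),
        (l • P - l ^ 2 • (P * Ring.inverse (B + l • P) * P)) ∂w := by
  have hX := isStrictlyPositive_opInvSqrt_conj hP hB
  have hsa := hX.isSelfAdjoint
  have hSS := opSqrt_mul_self hP
  have hSR := opSqrt_mul_opInvSqrt hP
  have hRS := opInvSqrt_mul_opSqrt hP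
  obtain ⟨hint, heq⟩ := integrableOn_and_cfc_integral_mul_div_add hw hX
  have hpt : ∀ l ∈ Set.Ioi (0 : ℝ),
      opSqrt P * cfc (fun t : ℝ => t * l / (t + l)) (opInvSqrt P * B * opInvSqrt P) * opSqrt P =
        l • P - l ^ 2 • (P * Ring.inverse (B + l • P) * P) := by
    intro l hl
    rw [cfc_mul_div_add hX hl, mul_sub, sub_mul, mul_smul_comm, mul_smul_comm, smul_mul_assoc,
      smul_mul_assoc, opSqrt_conj_ringInverse hP hB hl, mul_one, hSS]
  set S := opSqrt P
  set X := opInvSqrt P * B * opInvSqrt P with hXdef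
  have hSXS : S * X * S = B := by
    calc S * X * S = (S * opInvSqrt P) * B * (opInvSqrt P * S) := by
          rw [hXdef]; noncomm_ring
      _ = B := by rw [hSR, hRS, one_mul, mul_one]
  have hint' : IntegrableOn (fun l : ℝ => S * cfc (fun t : ℝ => t * l / (t + l)) X * S)
      (Set.Ioi 0) w := (hint.const_mul S).mul_const S
  refine ⟨hint'.congr_fun hpt measurableSet_Ioi, ?_⟩
  have hg : ContinuousOn (fun t : ℝ => ∫ l in Set.Ioi (0 : ℝ), t * l / (t + l) ∂w)
      (spectrum ℝ X) := by
    have : ContinuousOn (fun t : ℝ => f t - (a + b * t)) (spectrum ℝ X) :=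
      (hf.mono fun t ht => hX.spectrum_pos ht).sub (by fun_prop)
    refine this.congr fun t ht => ?_
    simp only [hrep t (hX.spectrum_pos ht)]
    ring
  have hcfc : cfc f X = a • (1 : H →L[ℂ] H) + b • X +
      ∫ l in Set.Ioi (0 : ℝ), cfc (fun t : ℝ => t * l / (t + l)) X ∂w := by
    rw [← heq, cfc_congr (fun t ht => hrep t (hX.spectrum_pos ht)),
      cfc_add X (fun t : ℝ => a + b * t)
        (fun t : ℝ => ∫ l in Set.Ioi (0 : ℝ), t * l / (t + l) ∂w) (by fun_prop) hg,
      cfc_const_add a (fun t : ℝ => b * t) X, cfc_const_mul_id b X,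
      Algebra.algebraMap_eq_smul_one]
  rw [persp, hcfc, mul_add, add_mul, mul_add, add_mul, mul_smul_comm, mul_smul_comm,
    smul_mul_assoc, smul_mul_assoc, hSXS, mul_one, hSS,
    ← integral_const_mul_of_integrable hint,
    ← integral_mul_const_of_integrable (hint.const_mul S),
    setIntegral_congr_fun measurableSet_Ioi hpt]

theorem isStrictlyPositive_segment {A B : H →L[ℂ] H} (hA : IsStrictlyPositive A)
    (hB : IsStrictlyPositive B) {t : ℝ} (ht : t ∈ Set.Icc (0 : ℝ) 1) :
    IsStrictlyPositive ((1 - t) • A + t • B) := by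
  rcases ht.2.lt_or_eq with h | rfl
  · exact (hA.smul (sub_pos.2 h)).add_nonneg (smul_nonneg ht.1 hB.nonneg)
  · simpa using hB

theorem hasDerivAt_ringInverse_segment {A B Q : H →L[ℂ] H} {t : ℝ}
    (hu : IsUnit ((1 - t) • A + t • B + Q)) :
    HasDerivAt (fun s : ℝ => Ring.inverse ((1 - s) • A + s • B + Q))
      (-(Ring.inverse ((1 - t) • A + t • B + Q) * (B - A) *
        Ring.inverse ((1 - t) • A + t • B + Q))) t := by
  have hX : HasDerivAt (fun s : ℝ => (1 - s) • A + s • B + Q) (B - A) t :=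
    (((((hasDerivAt_id t).const_sub 1).smul_const A).add
      ((hasDerivAt_id t).smul_const B)).add_const Q).congr_deriv
      (by rw [neg_smul, one_smul, one_smul, neg_add_eq_sub])
  obtain ⟨u, hu⟩ := hu
  have h := hasFDerivAt_ringInverse (𝕜 := ℝ) u
  rw [hu] at h
  refine (h.comp_hasDerivAt t hX).congr_deriv ?_
  rw [← hu, Ring.inverse_unit]
  simp

theorem integral_ringInverse_segment {A B P : H →L[ℂ] H} (hA : IsStrictlyPositive A)
    (hB : IsStrictlyPositive B) (hP : IsStrictlyPositive P) {l : ℝ} (hl : 0 < l) :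
    ∫ t in (0 : ℝ)..1, P * Ring.inverse ((1 - t) • A + t • B + l • P) * (B - A) *
        Ring.inverse ((1 - t) • A + t • B + l • P) * P =
      P * Ring.inverse (A + l • P) * P - P * Ring.inverse (B + l • P) * P := by
  have hd : ∀ t ∈ Set.uIcc (0 : ℝ) 1,
      HasDerivAt (fun s : ℝ => Ring.inverse ((1 - s) • A + s • B + l • P))
        (-(Ring.inverse ((1 - t) • A + t • B + l • P) * (B - A) *
          Ring.inverse ((1 - t) • A + t • B + l • P))) t := fun t ht =>
    hasDerivAt_ringInverse_segment (isStrictlyPositive_add_smul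
      (isStrictlyPositive_segment hA hB (by rwa [Set.uIcc_of_le zero_le_one] at ht)) hP hl).isUnit
  have hd' : ∀ t ∈ Set.uIcc (0 : ℝ) 1,
      HasDerivAt (fun s : ℝ => -(P * Ring.inverse ((1 - s) • A + s • B + l • P) * P))
        (P * Ring.inverse ((1 - t) • A + t • B + l • P) * (B - A) *
          Ring.inverse ((1 - t) • A + t • B + l • P) * P) t := by
    intro t ht
    refine (((hd t ht).const_mul P).mul_const P).neg.congr_deriv ?_
    rw [mul_neg, neg_mul, neg_neg]
    simp only [mul_assoc]
  have hc : ContinuousOn (fun s : ℝ => Ring.inverse ((1 - s) • A + s • B + l • P))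
      (Set.uIcc 0 1) := fun t ht => (hd t ht).continuousAt.continuousWithinAt
  rw [intervalIntegral.integral_eq_sub_of_hasDerivAt hd'
    (ContinuousOn.intervalIntegrable (by fun_prop))]
  simp only [sub_self, zero_smul, one_smul, sub_zero, zero_add, add_zero]
  abel

/-- **Theorem 2.1.** If `f(t) = a + b t + ∫₀^∞ tλ/(t+λ) dw(λ)` on `(0,∞)`, then for all
strictly positive operators `A, B, P`,
`𝒫_f(B,P) - 𝒫_f(A,P) = b(B - A) + ∫₀^∞ λ² [∫₀¹ P((1-t)A + tB + λP)⁻¹ (B - A) ((1-t)A + tB + λP)⁻¹ P dt] dw(λ)`. -/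
theorem stmt_1 (f : ℝ → ℝ) (a b : ℝ) (hb : 0 ≤ b) (w : Measure ℝ)
    (hf : ContinuousOn f (Set.Ioi 0))
    (hw : IntegrableOn (fun l => l / (1 + l)) (Set.Ioi 0) w)
    (hrep : ∀ t > (0:ℝ), f t = a + b * t + ∫ l in Set.Ioi 0, t * l / (t + l) ∂w)
    (A B P : H →L[ℂ] H) (hA : StrictlyPos A) (hB : StrictlyPos B) (hP : StrictlyPos P) :
    persp f B P - persp f A P = b • (B - A) +
      ∫ l in Set.Ioi (0:ℝ), l ^ 2 •
        (∫ t in (0:ℝ)..1, P * Ring.inverse ((1 - t) • A + t • B + l • P) * (B - A) *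
          Ring.inverse ((1 - t) • A + t • B + l • P) * P) ∂w := by
  rw [strictlyPos_iff_isStrictlyPositive] at hA hB hP
  obtain ⟨hiA, hpA⟩ := integrableOn_and_persp_eq hf hw hrep hA hP
  obtain ⟨hiB, hpB⟩ := integrableOn_and_persp_eq hf hw hrep hB hP
  have hI : ∫ l in Set.Ioi (0 : ℝ), l ^ 2 •
        (∫ t in (0 : ℝ)..1, P * Ring.inverse ((1 - t) • A + t • B + l • P) * (B - A) *
          Ring.inverse ((1 - t) • A + t • B + l • P) * P) ∂w =
      (∫ l in Set.Ioi (0 : ℝ), (l • P - l ^ 2 • (P * Ring.inverse (B + l • P) * P)) ∂w) -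
        ∫ l in Set.Ioi (0 : ℝ), (l • P - l ^ 2 • (P * Ring.inverse (A + l • P) * P)) ∂w := by
    rw [← integral_sub hiB hiA]
    refine setIntegral_congr_fun measurableSet_Ioi fun l hl => ?_
    simp only [integral_ringInverse_segment hA hB hP hl, smul_sub]
    abel
  rw [hI, hpA, hpB, smul_sub]
  abel
end

section
/- Let f : (0,∞) → ℝ admit the representation f(t) = a + b·t + ∫₀^∞ (tλ)/(t+λ) dw(λ) for all t > 0, where a ∈ ℝ, b ≥ 0 and w is a positive measure on (0,∞) with ∫₀^∞ λ/(1+λ) dw(λ) < ∞. Then the transpose f̃(t) := t·f(1/t) satisfies, for all strictly positive operators U, V on a complex Hilbert space H, f̃(V) − f̃(U) = a(V − U) + ∫₀^∞ λ [ ∫₀¹ (I + λ((1−t)U + tV))⁻¹ (V − U) (I + λ((1−t)U + tV))⁻¹ dt ] dw(λ), where f̃(U), f̃(V) are defined by the continuous functional calculus. -/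
open MeasureTheory

variable {H : Type*} [NormedAddCommGroup H] [InnerProductSpace ℂ H] [CompleteSpace H]

section CStarAlgebra

open Set

variable {A : Type*} [CStarAlgebra A] [PartialOrder A] [StarOrderedRing A]

/-- On the segment between two nonnegative elements, the derivative of the resolvent-type function
`t ↦ -(1 + l((1-t)u + tv))⁻¹` integrates to the difference of its endpoint values. -/
lemma smul_integral_ringInverse_mul_mul {u v : A} (hu : 0 ≤ u) (hv : 0 ≤ v) {l : ℝ} (hl : 0 ≤ l) :
    l • (∫ t in (0:ℝ)..1, Ring.inverse (1 + l • ((1 - t) • u + t • v)) * (v - u) *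
      Ring.inverse (1 + l • ((1 - t) • u + t • v))) =
    Ring.inverse (1 + l • u) - Ring.inverse (1 + l • v) := by
  set p : ℝ → A := fun t => 1 + l • ((1 - t) • u + t • v) with hp
  have hunit : ∀ t ∈ uIcc (0:ℝ) 1, IsUnit (p t) := by
    intro t ht
    rw [uIcc_of_le zero_le_one] at ht
    refine ((isStrictlyPositive_one (A := A)).add_nonneg ?_).isUnit
    exact smul_nonneg hl (add_nonneg (smul_nonneg (by linarith [ht.2]) hu) (smul_nonneg ht.1 hv))
  have hderiv : ∀ t, HasDerivAt p (l • (v - u)) t := by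
    intro t
    have h := ((((hasDerivAt_id t).const_sub 1).smul_const u).add
      ((hasDerivAt_id t).smul_const v)).const_smul l |>.const_add 1
    exact h.congr_deriv (by rw [neg_one_smul, one_smul, neg_add_eq_sub])
  have hcont : ContinuousOn (fun t => Ring.inverse (p t)) (uIcc 0 1) := by
    intro t ht
    obtain ⟨x, hx⟩ := hunit t ht
    have h : ContinuousAt (Ring.inverse : A → A) (p t) := hx ▸ NormedRing.inverse_continuousAt x
    exact (h.comp (hderiv t).continuousAt).continuousWithinAt
  have hftc := intervalIntegral.integral_eq_sub_of_hasDerivAt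
    (f := fun t => -Ring.inverse (p t))
    (f' := fun t => l • (Ring.inverse (p t) * (v - u) * Ring.inverse (p t))) (a := 0) (b := 1)
    (fun t ht => by
      obtain ⟨x, hx⟩ := hunit t ht
      have h : HasFDerivAt (Ring.inverse : A → A) _ (p t) :=
        hx ▸ hasFDerivAt_ringInverse (𝕜 := ℝ) x
      refine (h.comp_hasDerivAt t (hderiv t)).neg.congr_deriv ?_
      rw [← hx]
      simp)
    (((hcont.mul continuousOn_const).mul hcont).const_smul l).intervalIntegrable
  rw [intervalIntegral.integral_smul] at hftc
  rw [hftc]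
  simp [hp, neg_add_eq_sub]

lemma cfc_mul_div_one_add_mul {u : A} (hu : 0 ≤ u) {l : ℝ} (hl : 0 ≤ l) :
    cfc (fun z : ℝ => z * l / (1 + z * l)) u = 1 - Ring.inverse (1 + l • u) := by
  have hsa : IsSelfAdjoint u := .of_nonneg hu
  have hpos : ∀ z ∈ spectrum ℝ u, 1 + l * z ≠ 0 := fun z hz => by
    have := spectrum_nonneg_of_nonneg hu hz
    positivity
  have h1 : cfc (fun z : ℝ => 1 + l * z) u = 1 + l • u := by
    rw [cfc_const_add (1:ℝ) (fun z => l * z) u, cfc_const_mul_id l u, map_one]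
  rw [← h1, ← cfc_inv (fun z : ℝ => 1 + l * z) u hpos (by fun_prop) hsa, ← cfc_one ℝ u,
    ← cfc_sub (1 : ℝ → ℝ) (fun z => (1 + l * z)⁻¹) u (by fun_prop)
      (ContinuousOn.inv₀ (by fun_prop) hpos)]
  refine cfc_congr fun z hz => ?_
  have h := hpos z hz
  have h' : 1 + z * l ≠ 0 := by rwa [mul_comm z]
  simp only [Pi.one_apply]
  field_simp
  ring

lemma continuousOn_mul_div_one_add_mul {s : Set ℝ} (hs : s ⊆ Ioi 0) :
    ContinuousOn (Function.uncurry fun l z : ℝ => z * l / (1 + z * l)) (Ioi 0 ×ˢ s) := by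
  refine ContinuousOn.div (by fun_prop) (by fun_prop) ?_
  rintro ⟨l, z⟩ ⟨hl, hz⟩
  have hl : 0 < l := hl
  have hz : 0 < z := hs hz
  positivity

lemma norm_mul_div_one_add_mul_le {l z C : ℝ} (hl : 0 < l) (hz : 0 < z) (hzC : z ≤ C) :
    ‖z * l / (1 + z * l)‖ ≤ (1 + C) * (l / (1 + l)) := by
  rw [Real.norm_of_nonneg (by positivity)]
  have h : z * l / (1 + z * l) ≤ (1 + z) * (l / (1 + l)) := by
    rw [← mul_div_assoc, div_le_div_iff₀ (by positivity) (by positivity)]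
    have : 0 < z * z * l * l := by positivity
    nlinarith
  exact h.trans (by gcongr)

variable {w : Measure ℝ} {u : A}

lemma spectrum_subset_Ioi (hu : IsStrictlyPositive u) : spectrum ℝ u ⊆ Ioi 0 := fun _ hz =>
  (spectrum_nonneg_of_nonneg hu.nonneg hz).lt_of_ne' fun h =>
    spectrum.zero_notMem ℝ hu.isUnit (h ▸ hz)

lemma exists_norm_mul_div_one_add_mul_le (hu : IsStrictlyPositive u) :
    ∃ C : ℝ, ∀ᵐ l ∂(w.restrict (Ioi 0)), ∀ z ∈ spectrum ℝ u,
      ‖z * l / (1 + z * l)‖ ≤ (1 + C) * (l / (1 + l)) := by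
  obtain ⟨C, hC⟩ := (ContinuousFunctionalCalculus.isCompact_spectrum (R := ℝ) u).bddAbove
  exact ⟨C, ae_restrict_of_forall_mem measurableSet_Ioi fun l hl z hz =>
    norm_mul_div_one_add_mul_le hl (spectrum_subset_Ioi hu hz) (hC hz)⟩

lemma integrableOn_one_sub_ringInverse (hu : IsStrictlyPositive u)
    (hw : IntegrableOn (fun l => l / (1 + l)) (Ioi 0) w) :
    IntegrableOn (fun l : ℝ => 1 - Ring.inverse (1 + l • u)) (Ioi 0) w := by
  obtain ⟨C, hC⟩ := exists_norm_mul_div_one_add_mul_le (w := w) hu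
  refine (integrableOn_cfc measurableSet_Ioi (fun l z : ℝ => z * l / (1 + z * l)) _ u
    (continuousOn_mul_div_one_add_mul (spectrum_subset_Ioi hu)) hC
    (hw.const_mul (1 + C)).hasFiniteIntegral (.of_nonneg hu.nonneg)).congr_fun
    (fun l hl => cfc_mul_div_one_add_mul hu.nonneg (le_of_lt hl)) measurableSet_Ioi

lemma cfc_transpose_eq {f : ℝ → ℝ} {a b : ℝ} (hu : IsStrictlyPositive u)
    (hf : ContinuousOn f (Ioi 0))
    (hw : IntegrableOn (fun l => l / (1 + l)) (Ioi 0) w)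
    (hrep : ∀ t > (0:ℝ), f t = a + b * t + ∫ l in Ioi 0, t * l / (t + l) ∂w) :
    cfc (fun t : ℝ => t * f t⁻¹) u = algebraMap ℝ A b + a • u +
      ∫ l in Ioi (0:ℝ), (1 - Ring.inverse (1 + l • u)) ∂w := by
  obtain ⟨C, hC⟩ := exists_norm_mul_div_one_add_mul_le (w := w) hu
  have hsa : IsSelfAdjoint u := .of_nonneg hu.nonneg
  have hint := cfc_setIntegral measurableSet_Ioi (fun l z : ℝ => z * l / (1 + z * l)) _ u
    (continuousOn_mul_div_one_add_mul (spectrum_subset_Ioi hu)) hC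
    (hw.const_mul (1 + C)).hasFiniteIntegral hsa
  rw [setIntegral_congr_fun measurableSet_Ioi
    fun l hl => cfc_mul_div_one_add_mul hu.nonneg (le_of_lt hl)] at hint
  have heq : ∀ z ∈ Ioi (0:ℝ),
      z * f z⁻¹ = (b + a * z) + ∫ l in Ioi 0, z * l / (1 + z * l) ∂w := by
    intro z hz
    have hz : 0 < z := hz
    have hI : ∫ l in Ioi 0, z * l / (1 + z * l) ∂w = z * ∫ l in Ioi 0, z⁻¹ * l / (z⁻¹ + l) ∂w := by
      rw [← integral_const_mul]
      refine setIntegral_congr_fun measurableSet_Ioi fun l hl => ?_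
      have hl : 0 < l := hl
      field_simp
    rw [hrep z⁻¹ (inv_pos.2 hz), hI]
    field_simp
    ring
  have hcf : ContinuousOn (fun z => z * f z⁻¹) (spectrum ℝ u) := by
    refine ContinuousOn.mono ?_ (spectrum_subset_Ioi hu)
    refine continuousOn_id.mul (hf.comp (continuousOn_inv₀.mono fun z hz => ?_) fun z hz => ?_)
    · exact ne_of_gt hz
    · exact inv_pos.2 (mem_Ioi.1 hz)
  have hcI : ContinuousOn (fun z => ∫ l in Ioi 0, z * l / (1 + z * l) ∂w) (spectrum ℝ u) := by
    refine (hcf.sub (g := fun z => b + a * z) (by fun_prop)).congr fun z hz => ?_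
    exact (sub_eq_of_eq_add' (heq z (spectrum_subset_Ioi hu hz))).symm
  rw [cfc_congr fun z hz => heq z (spectrum_subset_Ioi hu hz),
    cfc_add u (fun z => b + a * z) _ (by fun_prop) hcI, hint,
    cfc_const_add b (fun z => a * z) u, cfc_const_mul_id a u]

/-- Integral formula for the difference of two values of the transpose. -/
lemma cfc_transpose_sub_cfc_transpose {f : ℝ → ℝ} {a b : ℝ} {v : A}
    (hu : IsStrictlyPositive u) (hv : IsStrictlyPositive v)
    (hf : ContinuousOn f (Ioi 0))
    (hw : IntegrableOn (fun l => l / (1 + l)) (Ioi 0) w)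
    (hrep : ∀ t > (0:ℝ), f t = a + b * t + ∫ l in Ioi 0, t * l / (t + l) ∂w) :
    cfc (fun t : ℝ => t * f t⁻¹) v - cfc (fun t : ℝ => t * f t⁻¹) u = a • (v - u) +
      ∫ l in Ioi (0:ℝ), l •
        (∫ t in (0:ℝ)..1, Ring.inverse (1 + l • ((1 - t) • u + t • v)) * (v - u) *
          Ring.inverse (1 + l • ((1 - t) • u + t • v))) ∂w := by
  rw [setIntegral_congr_fun measurableSet_Ioi fun l hl =>
      smul_integral_ringInverse_mul_mul hu.nonneg hv.nonneg (le_of_lt hl),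
    cfc_transpose_eq hu hf hw hrep, cfc_transpose_eq hv hf hw hrep, add_sub_add_comm,
    ← integral_sub (integrableOn_one_sub_ringInverse hv hw)
      (integrableOn_one_sub_ringInverse hu hw), add_sub_add_left_eq_sub, smul_sub]
  simp only [sub_sub_sub_cancel_left]

end CStarAlgebra

lemma StrictlyPos.isStrictlyPositive {K : Type*} [NormedAddCommGroup K] [InnerProductSpace ℂ K]
    {T : K →L[ℂ] K} (hT : StrictlyPos T) :
    IsStrictlyPositive T :=
  hT.2.isStrictlyPositive ((ContinuousLinearMap.nonneg_iff_isPositive T).2 hT.1)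

/-- **Lemma 2.2.** If `f(t) = a + b t + ∫₀^∞ tλ/(t+λ) dw(λ)` on `(0,∞)`, then the transpose
`f̃(t) = t f(1/t)` satisfies, for all strictly positive operators `U, V`,
`f̃(V) - f̃(U) = a(V - U) + ∫₀^∞ λ [∫₀¹ (I + λ((1-t)U + tV))⁻¹ (V - U) (I + λ((1-t)U + tV))⁻¹ dt] dw(λ)`. -/
theorem stmt_2 (f : ℝ → ℝ) (a b : ℝ) (hb : 0 ≤ b) (w : Measure ℝ)
    (hf : ContinuousOn f (Set.Ioi 0))
    (hw : IntegrableOn (fun l => l / (1 + l)) (Set.Ioi 0) w)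
    (hrep : ∀ t > (0:ℝ), f t = a + b * t + ∫ l in Set.Ioi 0, t * l / (t + l) ∂w)
    (U V : H →L[ℂ] H) (hU : StrictlyPos U) (hV : StrictlyPos V) :
    cfc (fun t : ℝ => t * f t⁻¹) V - cfc (fun t : ℝ => t * f t⁻¹) U = a • (V - U) +
      ∫ l in Set.Ioi (0:ℝ), l •
        (∫ t in (0:ℝ)..1, Ring.inverse (1 + l • ((1 - t) • U + t • V)) * (V - U) *
          Ring.inverse (1 + l • ((1 - t) • U + t • V))) ∂w := by
  exact cfc_transpose_sub_cfc_transpose hU.isStrictlyPositive hV.isStrictlyPositive hf hw hrep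
end

section
/- For all strictly positive operators U, V on a complex Hilbert space H, ln V − ln U = ∫₀^∞ [ ∫₀¹ (λ + (1−t)U + tV)⁻¹ (V − U) (λ + (1−t)U + tV)⁻¹ dt ] dλ, where ln U, ln V are defined by the continuous functional calculus and λ + T abbreviates λ·I + T. -/
open MeasureTheory

variable {H : Type*} [NormedAddCommGroup H] [InnerProductSpace ℂ H] [CompleteSpace H]

open Filter Topology Set

/-- An integrable majorant of the integrand in the integral representation of the logarithm. -/
lemma abs_inv_sub_inv_le {c b l x : ℝ} (hc : 0 < c) (hc1 : c ≤ 1) (hcx : c ≤ x) (hxb : x ≤ b)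
    (hl : 0 < l) : |(1 + l)⁻¹ - (l + x)⁻¹| ≤ (b + 1) * ((c + l) ^ 2)⁻¹ := by
  have h1 : 0 < 1 + l := by linarith
  have h2 : 0 < l + x := by linarith
  have h3 : (1 + l)⁻¹ - (l + x)⁻¹ = (x - 1) * ((1 + l) * (l + x))⁻¹ := by
    field_simp
    ring
  rw [h3, abs_mul, abs_of_pos (a := ((1 + l) * (l + x))⁻¹) (by positivity)]
  have h4 : |x - 1| ≤ b + 1 := abs_le.2 ⟨by linarith, by linarith⟩
  have hb : 0 ≤ b + 1 := by linarith
  have h5 : (c + l) ^ 2 ≤ (1 + l) * (l + x) := by nlinarith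
  gcongr

lemma integrableOn_Ioi_inv_add_sq {c : ℝ} (hc : 0 < c) :
    IntegrableOn (fun l : ℝ => ((c + l) ^ 2)⁻¹) (Ioi 0) := by
  refine integrableOn_Ioi_deriv_of_nonneg' (g := fun l => -(c + l)⁻¹) (l := -0) (fun l hl => ?_)
    (fun l _ => by positivity) ?_
  · have hl' : 0 < c + l := add_pos_of_pos_of_nonneg hc hl
    have := (((hasDerivAt_id l).const_add c).inv hl'.ne').neg
    convert! this using 1
    simp [neg_div]
  · exact (tendsto_inv_atTop_zero.comp (tendsto_atTop_add_const_left _ c tendsto_id)).neg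

lemma integral_Ioi_inv_sub_inv {x : ℝ} (hx : 0 < x) :
    ∫ l in Ioi (0 : ℝ), ((1 + l)⁻¹ - (l + x)⁻¹) = Real.log x := by
  have hlim : Tendsto (fun l : ℝ => Real.log (1 + l) - Real.log (l + x)) atTop (𝓝 0) := by
    have h : Tendsto (fun l : ℝ => 1 + (1 - x) * (l + x)⁻¹) atTop (𝓝 (1 + (1 - x) * 0)) :=
      ((tendsto_inv_atTop_zero.comp
        (tendsto_atTop_add_const_right _ x tendsto_id)).const_mul _).const_add _
    rw [mul_zero, add_zero] at h
    have h' := (Real.continuousAt_log one_ne_zero).tendsto.comp h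
    rw [Real.log_one] at h'
    refine h'.congr' ?_
    filter_upwards [eventually_gt_atTop 0] with l hl
    have h2 : 0 < l + x := by linarith
    rw [← Real.log_div (by linarith) h2.ne', Function.comp_apply]
    congr 1
    field_simp
    ring
  have hint : IntegrableOn (fun l : ℝ => (1 + l)⁻¹ - (l + x)⁻¹) (Ioi 0) := by
    have hc : 0 < min x 1 := lt_min hx one_pos
    refine ((integrableOn_Ioi_inv_add_sq hc).const_mul (x + 1)).mono'
      (by fun_prop) (ae_restrict_of_forall_mem measurableSet_Ioi fun l hl => ?_)
    exact abs_inv_sub_inv_le hc (min_le_right _ _) (min_le_left _ _) le_rfl hl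
  rw [integral_Ioi_of_hasDerivAt_of_tendsto' (f := fun l => Real.log (1 + l) - Real.log (l + x))
    (fun l hl => ?_) hint hlim]
  · simp
  · have hl' : 0 ≤ l := hl
    have h1 := ((hasDerivAt_id l).const_add 1).log (by simp only [id]; linarith)
    have h2 := ((hasDerivAt_id l).add_const x).log (by simp only [id]; linarith)
    simpa using! h1.sub h2

section CStarAlgebra

variable {A : Type*} [CStarAlgebra A] [PartialOrder A] [StarOrderedRing A]

lemma IsStrictlyPositive.exists_spectrum_subset_Icc {a : A} (ha : IsStrictlyPositive a) :
    ∃ c b : ℝ, 0 < c ∧ c ≤ 1 ∧ spectrum ℝ a ⊆ Icc c b := by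
  have hK : IsCompact (spectrum ℝ a) := isCompact_iff_compactSpace.2 inferInstance
  obtain ⟨b, hb⟩ := hK.bddAbove
  rcases (spectrum ℝ a).eq_empty_or_nonempty with h | h
  · exact ⟨1, 1, one_pos, le_rfl, by simp [h]⟩
  · obtain ⟨m, hm, hmin⟩ := hK.exists_isLeast h
    have hm0 : 0 < m := ha.spectrum_pos hm
    exact ⟨min m 1, b, lt_min hm0 one_pos, min_le_right _ _,
      fun x hx => ⟨(min_le_left _ _).trans (hmin hx), hb hx⟩⟩

lemma cfc_inv_sub_inv_add {a : A} (ha : IsStrictlyPositive a) {l : ℝ} (hl : 0 < l) :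
    cfc (fun x : ℝ => (1 + l)⁻¹ - (l + x)⁻¹) a =
      algebraMap ℝ A (1 + l)⁻¹ - Ring.inverse (l • 1 + a) := by
  have hsa : IsSelfAdjoint a := ha.isSelfAdjoint
  have hne : ∀ x ∈ spectrum ℝ a, l + x ≠ 0 := fun x hx => (add_pos hl (ha.spectrum_pos hx)).ne'
  have hcont : ContinuousOn (fun x : ℝ => l + x) (spectrum ℝ a) := by fun_prop
  rw [cfc_sub (fun _ : ℝ => (1 + l)⁻¹) (fun x : ℝ => (l + x)⁻¹) a (by fun_prop) (hcont.inv₀ hne),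
    cfc_const _ a, cfc_inv (fun x : ℝ => l + x) a hne, cfc_const_add l (fun x => x) a, cfc_id' ℝ a,
    Algebra.algebraMap_eq_smul_one l]

lemma integrableOn_cfc_inv_sub_inv_and_cfc_log_eq {a : A} (ha : IsStrictlyPositive a) :
    IntegrableOn (fun l : ℝ => cfc (fun x : ℝ => (1 + l)⁻¹ - (l + x)⁻¹) a) (Ioi 0) ∧
      cfc Real.log a = ∫ l in Ioi (0 : ℝ), cfc (fun x : ℝ => (1 + l)⁻¹ - (l + x)⁻¹) a := by
  have hsa : IsSelfAdjoint a := ha.isSelfAdjoint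
  obtain ⟨c, b, hc, hc1, hsub⟩ := ha.exists_spectrum_subset_Icc
  have hcont : ContinuousOn (Function.uncurry fun l x : ℝ => (1 + l)⁻¹ - (l + x)⁻¹)
      (Ioi 0 ×ˢ spectrum ℝ a) := by
    rintro ⟨l, x⟩ ⟨hl : 0 < l, hx⟩
    have hx0 : 0 < x := hc.trans_le (hsub hx).1
    have h1 : 1 + l ≠ 0 := by positivity
    have h2 : l + x ≠ 0 := by positivity
    refine ContinuousAt.continuousWithinAt ?_
    exact ((continuousAt_const.add continuousAt_fst).inv₀ h1).sub
      ((continuousAt_fst.add continuousAt_snd).inv₀ h2)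
  have hbound : ∀ᵐ l ∂(volume.restrict (Ioi (0 : ℝ))), ∀ x ∈ spectrum ℝ a,
      ‖(1 + l)⁻¹ - (l + x)⁻¹‖ ≤ (b + 1) * ((c + l) ^ 2)⁻¹ :=
    ae_restrict_of_forall_mem measurableSet_Ioi fun l hl x hx =>
      abs_inv_sub_inv_le hc hc1 (hsub hx).1 (hsub hx).2 hl
  have hfin := ((integrableOn_Ioi_inv_add_sq hc).const_mul (b + 1)).hasFiniteIntegral
  refine ⟨integrableOn_cfc measurableSet_Ioi _ _ a hcont hbound hfin, ?_⟩
  rw [← cfc_setIntegral measurableSet_Ioi _ _ a hcont hbound hfin]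
  exact cfc_congr fun x hx => (integral_Ioi_inv_sub_inv (hc.trans_le (hsub hx).1)).symm

/-- `ln b - ln a = ∫₀^∞ ((l + a)⁻¹ - (l + b)⁻¹) dl` for strictly positive `a` and `b`. -/
lemma cfc_log_sub_cfc_log {a b : A} (ha : IsStrictlyPositive a) (hb : IsStrictlyPositive b) :
    cfc Real.log b - cfc Real.log a =
      ∫ l in Ioi (0 : ℝ), (Ring.inverse (l • 1 + a) - Ring.inverse (l • 1 + b)) := by
  obtain ⟨ha1, ha2⟩ := integrableOn_cfc_inv_sub_inv_and_cfc_log_eq ha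
  obtain ⟨hb1, hb2⟩ := integrableOn_cfc_inv_sub_inv_and_cfc_log_eq hb
  rw [ha2, hb2, ← integral_sub hb1 ha1]
  refine setIntegral_congr_fun measurableSet_Ioi fun l hl => ?_
  simp only [cfc_inv_sub_inv_add ha hl, cfc_inv_sub_inv_add hb hl]
  abel

end CStarAlgebra

/-- The fundamental theorem of calculus for the inverse along a segment of invertible elements. -/
lemma integral_ringInverse_mul_sub_mul_ringInverse {A : Type*} [NormedRing A] [NormedAlgebra ℝ A]
    [CompleteSpace A] {a b : A} (h : ∀ t ∈ Icc (0 : ℝ) 1, IsUnit ((1 - t) • a + t • b)) :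
    ∫ t in (0 : ℝ)..1, Ring.inverse ((1 - t) • a + t • b) * (b - a) *
      Ring.inverse ((1 - t) • a + t • b) = Ring.inverse a - Ring.inverse b := by
  have hline (t : ℝ) : HasDerivAt (fun t : ℝ => (1 - t) • a + t • b) (b - a) t := by
    convert! (((hasDerivAt_id t).const_sub 1).smul_const a).add
      ((hasDerivAt_id t).smul_const b) using 1
    simp only [neg_smul, one_smul]
    abel
  have hderiv : ∀ t ∈ Icc (0 : ℝ) 1,
      HasDerivAt (fun t : ℝ => -Ring.inverse ((1 - t) • a + t • b))
        (Ring.inverse ((1 - t) • a + t • b) * (b - a) * Ring.inverse ((1 - t) • a + t • b)) t := by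
    intro t ht
    obtain ⟨u, hu⟩ := h t ht
    have hinv := hasFDerivAt_ringInverse (𝕜 := ℝ) u
    rw [hu] at hinv
    have := (hinv.comp_hasDerivAt t (hline t)).neg
    rw [← hu, Ring.inverse_unit]
    simpa [Function.comp_def] using! this
  have hcont : ContinuousOn (fun t : ℝ => Ring.inverse ((1 - t) • a + t • b)) (Icc 0 1) :=
    fun t ht => by
      simpa only [Pi.neg_def, neg_neg] using (hderiv t ht).continuousAt.neg.continuousWithinAt
  rw [← uIcc_of_le zero_le_one] at hderiv hcont
  rw [intervalIntegral.integral_eq_sub_of_hasDerivAt hderiv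
    ((hcont.mul continuousOn_const).mul hcont).intervalIntegrable]
  simp only [sub_self, zero_smul, one_smul, sub_zero, zero_add, add_zero]
  abel

/-- **Lemma 2.3.** For all strictly positive operators `U, V`,
`ln V - ln U = ∫₀^∞ [∫₀¹ (λ + (1-t)U + tV)⁻¹ (V - U) (λ + (1-t)U + tV)⁻¹ dt] dλ`. -/
theorem stmt_11 (U V : H →L[ℂ] H) (hU : StrictlyPos U) (hV : StrictlyPos V) :
    cfc Real.log V - cfc Real.log U =
      ∫ l in Set.Ioi (0:ℝ),
        (∫ t in (0:ℝ)..1, Ring.inverse (l • 1 + (1 - t) • U + t • V) * (V - U) *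
          Ring.inverse (l • 1 + (1 - t) • U + t • V)) := by
  have hU' : IsStrictlyPositive U :=
    ⟨(ContinuousLinearMap.nonneg_iff_isPositive U).2 hU.1, hU.2⟩
  have hV' : IsStrictlyPositive V :=
    ⟨(ContinuousLinearMap.nonneg_iff_isPositive V).2 hV.1, hV.2⟩
  rw [cfc_log_sub_cfc_log hU' hV']
  refine setIntegral_congr_fun measurableSet_Ioi fun l (hl : 0 < l) => ?_
  have hseg (t : ℝ) : l • 1 + (1 - t) • U + t • V =
      (1 - t) • (l • 1 + U) + t • (l • 1 + V) := by
    module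
  have hsub : V - U = (l • 1 + V) - (l • 1 + U) := by abel
  simp only [hseg]
  rw [hsub, integral_ringInverse_mul_sub_mul_ringInverse fun t ht => ?_]
  rw [← hseg, add_assoc]
  have hl1 : IsStrictlyPositive (l • (1 : H →L[ℂ] H)) := .smul hl isStrictlyPositive_one
  exact (hl1.add_nonneg (add_nonneg (smul_nonneg (sub_nonneg.2 ht.2) hU'.nonneg)
    (smul_nonneg ht.1 hV'.nonneg))).isUnit
end

section
/- For all strictly positive operators C, D on a complex Hilbert space H, C⁻¹ − D⁻¹ = ∫₀¹ ((1−t)C + tD)⁻¹ (D − C) ((1−t)C + tD)⁻¹ dt. -/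
open MeasureTheory

variable {H : Type*} [NormedAddCommGroup H] [InnerProductSpace ℂ H] [CompleteSpace H]

/-- The derivative of the inverse along the affine path from `a` to `b`. -/
theorem hasDerivAt_ringInverse_affine {A : Type*} [NormedRing A] [NormedAlgebra ℝ A]
    [CompleteSpace A] (a b : A) {t : ℝ} (ht : IsUnit ((1 - t) • a + t • b)) :
    HasDerivAt (fun s : ℝ => Ring.inverse ((1 - s) • a + s • b))
      (-(Ring.inverse ((1 - t) • a + t • b) * (b - a) *
        Ring.inverse ((1 - t) • a + t • b))) t := by
  have hpath : HasDerivAt (fun s : ℝ => (1 - s) • a + s • b) (b - a) t := by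
    have h := (((hasDerivAt_id t).const_sub 1).smul_const a).add
      ((hasDerivAt_id t).smul_const b)
    simpa [sub_eq_neg_add] using! h
  obtain ⟨u, hu⟩ := ht
  have hinv : HasFDerivAt Ring.inverse
      (-ContinuousLinearMap.mulLeftRight ℝ A ↑u⁻¹ ↑u⁻¹) ((1 - t) • a + t • b) :=
    hu ▸ hasFDerivAt_ringInverse u
  simpa [← hu] using! hinv.comp_hasDerivAt t hpath

/-- The difference of inverses as an integral along a segment of units. -/
theorem ringInverse_sub_ringInverse_eq_integral {A : Type*} [NormedRing A] [NormedAlgebra ℝ A]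
    [CompleteSpace A] (a b : A)
    (hab : ∀ t ∈ Set.Icc (0 : ℝ) 1, IsUnit ((1 - t) • a + t • b)) :
    Ring.inverse a - Ring.inverse b =
      ∫ t in (0 : ℝ)..1, Ring.inverse ((1 - t) • a + t • b) * (b - a) *
        Ring.inverse ((1 - t) • a + t • b) := by
  rw [← Set.uIcc_of_le zero_le_one] at hab
  have hderiv := fun t ht => hasDerivAt_ringInverse_affine a b (hab t ht)
  have hcont := HasDerivAt.continuousOn hderiv
  have hint := intervalIntegral.integral_eq_sub_of_hasDerivAt hderiv
    ((hcont.mul continuousOn_const).mul hcont).neg.intervalIntegrable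
  rw [intervalIntegral.integral_neg] at hint
  rw [← neg_eq_iff_eq_neg.mpr hint.symm]
  simp

/-- Convex combinations of strictly positive operators are invertible. -/
theorem StrictlyPos.isUnit_convexCombination {C D : H →L[ℂ] H} (hC : StrictlyPos C)
    (hD : StrictlyPos D) {t : ℝ} (ht : t ∈ Set.Icc (0 : ℝ) 1) :
    IsUnit ((1 - t) • C + t • D) := by
  have hC' : IsStrictlyPositive C :=
    hC.2.isStrictlyPositive (C.nonneg_iff_isPositive.mpr hC.1)
  have hD' : IsStrictlyPositive D :=
    hD.2.isStrictlyPositive (D.nonneg_iff_isPositive.mpr hD.1)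
  rcases ht.1.eq_or_lt with rfl | h0
  · simpa using hC.2
  · exact ((hD'.smul h0).nonneg_add
      (smul_nonneg (sub_nonneg.mpr ht.2) hC'.nonneg)).isUnit

/-- **(2.5).** For all strictly positive operators `C, D`,
`C⁻¹ - D⁻¹ = ∫₀¹ ((1-t)C + tD)⁻¹ (D - C) ((1-t)C + tD)⁻¹ dt`. -/
theorem stmt_14 (C D : H →L[ℂ] H) (hC : StrictlyPos C) (hD : StrictlyPos D) :
    Ring.inverse C - Ring.inverse D =
      ∫ t in (0:ℝ)..1, Ring.inverse ((1 - t) • C + t • D) * (D - C) *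
        Ring.inverse ((1 - t) • C + t • D) := by
  exact ringInverse_sub_ringInverse_eq_integral C D
    fun _ ht => hC.isUnit_convexCombination hD ht
end
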